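/- Let ε ∈ ℂ be a primitive 6th root of unity. The stabilizer Stab(xy(x³+y³)) ⊂ SL(2,ℂ) equals the subgroup generated by diag(ε, ε⁻¹) and [[0,i],[i,0]] (the binary dihedral group D₃, of order 12). -/

import Mathlib

open MvPolynomial Matrix

noncomputable section

/-- Polynomials in two variables `x = X 0`, `y = X 1` over `ℂ`. -/
abbrev BPoly : Type := MvPolynomial (Fin 2) ℂ

/-- The variable `x`. -/
def Px : BPoly := X 0

/-- The variable `y`. -/
def Py : BPoly := X 1

/-- Substitution action of a 2×2 matrix on polynomials in two variables:
for `A = [[p,q],[r,s]]`, `(f·A)(x,y) = f(px+qy, rx+sy)`. -/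
def matAct (A : Matrix (Fin 2) (Fin 2) ℂ) (f : BPoly) : BPoly :=
  bind₁ (fun i => C (A i 0) * Px + C (A i 1) * Py) f

/-- `f` is semi-invariant under `A`: `f·A = c·f` for some nonzero scalar `c`. -/
def SemiInv (A : Matrix (Fin 2) (Fin 2) ℂ) (f : BPoly) : Prop :=
  ∃ c : ℂ, c ≠ 0 ∧ matAct A f = C c * f

/-- The stabilizer of `f` inside `SL(2,ℂ)`: all matrices under which `f` is
semi-invariant. -/
def Stab (f : BPoly) : Set (SpecialLinearGroup (Fin 2) ℂ) :=
  {A | SemiInv (A : Matrix (Fin 2) (Fin 2) ℂ) f}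

/-- `f` is a (nonzero) binary form: nonzero and homogeneous of some degree. -/
def IsBinaryForm (f : BPoly) : Prop :=
  f ≠ 0 ∧ ∃ d : ℕ, f.IsHomogeneous d

/-- `f` is `SL(2,ℂ)`-equivalent to `g` up to a nonzero scalar:
`c·(f·A) = g` for some `A ∈ SL(2,ℂ)` and `c ≠ 0`. -/
def EquivForm (f g : BPoly) : Prop :=
  ∃ A : SpecialLinearGroup (Fin 2) ℂ, ∃ c : ℂ, c ≠ 0 ∧
    C c * matAct (A : Matrix (Fin 2) (Fin 2) ℂ) f = g


/-- The form `f·A` takes at `v` the value of `f` at `A v`. -/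
lemma eval_matAct (A : Matrix (Fin 2) (Fin 2) ℂ) (f : BPoly) (v : Fin 2 → ℂ) :
    eval v (matAct A f) = eval (A *ᵥ v) f := by
  have h : (fun i => eval v (C (A i 0) * Px + C (A i 1) * Py)) = A *ᵥ v := by
    funext i
    simp [Px, Py, mulVec, dotProduct, Fin.sum_univ_two]
  rw [← h, matAct, ← aeval_eq_eval, ← aeval_eq_eval]
  exact aeval_bind₁ _ _ _

lemma semiInv_iff (A : Matrix (Fin 2) (Fin 2) ℂ) (f : BPoly) :
    SemiInv A f ↔ ∃ c : ℂ, c ≠ 0 ∧ ∀ v, eval (A *ᵥ v) f = c * eval v f := by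
  refine exists_congr fun c => and_congr_right fun _ => ⟨fun h v => ?_, fun h => ?_⟩
  · rw [← eval_matAct, h, map_mul, eval_C]
  · refine MvPolynomial.funext fun v => ?_
    rw [eval_matAct, h, map_mul, eval_C]

/-- The stabilizer of `f`, as a subgroup of `SL(2,ℂ)`. -/
def stabSubgroup (f : BPoly) : Subgroup (SpecialLinearGroup (Fin 2) ℂ) where
  carrier := Stab f
  one_mem' := (semiInv_iff _ _).2 ⟨1, one_ne_zero, fun v => by simp⟩
  mul_mem' {A B} hA hB := by
    obtain ⟨a, ha, hA⟩ := (semiInv_iff _ _).1 hA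
    obtain ⟨b, hb, hB⟩ := (semiInv_iff _ _).1 hB
    refine (semiInv_iff _ _).2 ⟨a * b, mul_ne_zero ha hb, fun v => ?_⟩
    rw [Matrix.SpecialLinearGroup.coe_mul, ← mulVec_mulVec, hA, hB, mul_assoc]
  inv_mem' {A} hA := by
    obtain ⟨a, ha, hA⟩ := (semiInv_iff _ _).1 hA
    refine (semiInv_iff _ _).2 ⟨a⁻¹, inv_ne_zero ha, fun v => ?_⟩
    have hinv : A.1 * A⁻¹.1 = 1 := congrArg Subtype.val (mul_inv_cancel A)
    have h : A.1 *ᵥ A⁻¹.1 *ᵥ v = v := by rw [mulVec_mulVec, hinv, one_mulVec]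
    rw [eq_inv_mul_iff_mul_eq₀ ha, ← hA, h]

/-- Semi-invariance of the quintic `xy(x³+y³)` under `A`, in terms of its values. -/
lemma semiInv_quintic_iff (A : Matrix (Fin 2) (Fin 2) ℂ) :
    SemiInv A (Px * Py * (Px ^ 3 + Py ^ 3)) ↔ ∃ c : ℂ, c ≠ 0 ∧ ∀ x y : ℂ,
      (A 0 0 * x + A 0 1 * y) * (A 1 0 * x + A 1 1 * y) *
        ((A 0 0 * x + A 0 1 * y) ^ 3 + (A 1 0 * x + A 1 1 * y) ^ 3) =
      c * (x * y * (x ^ 3 + y ^ 3)) := by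
  rw [semiInv_iff]
  refine exists_congr fun c => and_congr_right fun _ => ⟨fun h x y => ?_, fun h v => ?_⟩
  · simpa [Px, Py, mulVec, dotProduct, Fin.sum_univ_two] using h ![x, y]
  · simpa [Px, Py, mulVec, dotProduct, Fin.sum_univ_two] using h (v 0) (v 1)

/-- A unimodular substitution preserving `xy(x³+y³)` up to a scalar is diagonal or
antidiagonal, and its nonzero entries have equal cubes. -/
lemma entries_of_quintic_semiInv {p q r s c : ℂ} (hdet : p * s - q * r = 1)
    (h : ∀ x y : ℂ, (p * x + q * y) * (r * x + s * y) *
      ((p * x + q * y) ^ 3 + (r * x + s * y) ^ 3) = c * (x * y * (x ^ 3 + y ^ 3))) :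
    (q = 0 ∧ r = 0 ∧ p ^ 3 = s ^ 3) ∨ (p = 0 ∧ s = 0 ∧ q ^ 3 = r ^ 3) := by
  have e0 := h 1 0
  have e1 := h 1 1
  have e2 := h 1 (-1)
  have e3 := h 1 2
  have e4 := h 1 (-2)
  have e5 := h 0 1
  have x5 : p * r * (p ^ 3 + r ^ 3) = 0 := by linear_combination e0
  have y5 : q * s * (q ^ 3 + s ^ 3) = 0 := by linear_combination e5
  have x4y : (p * s + q * r) * (p ^ 3 + r ^ 3) + 3 * (p * r) * (p ^ 2 * q + r ^ 2 * s) = c := by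
    linear_combination (8 * (e1 - e2) / 2 - (e3 - e4) / 2 + 24 * e5) / 6
  have x3y2 : 3 * (p * r) * (p * q ^ 2 + r * s ^ 2) + 3 * (p * s + q * r) *
      (p ^ 2 * q + r ^ 2 * s) + q * s * (p ^ 3 + r ^ 3) = 0 := by
    linear_combination (16 * (e1 + e2) / 2 - (e3 + e4) / 2 - 15 * e0) / 12
  have x2y3 : p * r * (q ^ 3 + s ^ 3) + 3 * (p * s + q * r) * (p * q ^ 2 + r * s ^ 2) +
      3 * (q * s) * (p ^ 2 * q + r ^ 2 * s) = 0 := by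
    linear_combination ((e3 - e4) / 2 - (e1 - e2) - 30 * e5) / 6
  have xy4 : (p * s + q * r) * (q ^ 3 + s ^ 3) + 3 * (q * s) * (p * q ^ 2 + r * s ^ 2) = c := by
    linear_combination ((e3 + e4) / 2 - 4 * (e1 + e2) / 2 + 3 * e0) / 12
  clear h e0 e1 e2 e3 e4 e5
  by_cases hp : p = 0
  · subst hp
    have hqr : q * r ≠ 0 := fun h0 => by simp [h0] at hdet
    have hs : s = 0 := by
      have : q * r * r ^ 2 * s = 0 := by linear_combination x3y2 / 4
      simp_all
    subst hs
    refine Or.inr ⟨rfl, rfl, mul_left_cancel₀ hqr ?_⟩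
    linear_combination xy4 - x4y
  by_cases hr : r = 0
  · subst hr
    have hps : p * s ≠ 0 := fun h0 => by simp [h0] at hdet
    have hq : q = 0 := by
      have : p * s * p ^ 2 * q = 0 := by linear_combination x3y2 / 4
      simp_all
    subst hq
    refine Or.inl ⟨rfl, rfl, mul_left_cancel₀ hps ?_⟩
    linear_combination x4y - xy4
  exfalso
  have hpr := mul_ne_zero hp hr
  have hP : p ^ 3 + r ^ 3 = 0 := (mul_eq_zero.1 x5).resolve_left hpr
  rcases mul_eq_zero.1 y5 with hqs | hQ
  · rcases mul_eq_zero.1 hqs with hq | hs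
    · subst hq
      have hs : s = 0 := by
        have : p * r * s ^ 3 = 0 := by linear_combination x2y3 / 4
        simp_all
      simp [hs] at hdet
    · subst hs
      have hq : q = 0 := by
        have : p * r * q ^ 3 = 0 := by linear_combination x2y3 / 4
        simp_all
      simp [hq] at hdet
  · have hb : p * q ^ 2 + r * s ^ 2 = 0 := by
      refine (mul_eq_zero.1 ?_).resolve_left hpr
      linear_combination x3y2 / 6 - 2 / 3 * (q * s) * hP
    have hs : s = 0 := by
      refine pow_eq_zero_iff two_ne_zero |>.1 ?_
      linear_combination p * hQ - q * hb - s ^ 2 * hdet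
    simp_all

/-- The stabilizer of `xy(x³+y³)` in `SL(2,ℂ)` is the binary dihedral group `D₃`
of order 12, generated by `diag(ε, ε⁻¹)` (`ε` a primitive 6th root of unity) and
`[[0,i],[i,0]]`. -/
theorem stab_quintic_dihedral
    (ε : ℂ) (hε : IsPrimitiveRoot ε 6)
    (D S : SpecialLinearGroup (Fin 2) ℂ)
    (hD : (D : Matrix (Fin 2) (Fin 2) ℂ) = !![ε, 0; 0, ε⁻¹])
    (hS : (S : Matrix (Fin 2) (Fin 2) ℂ) = !![0, Complex.I; Complex.I, 0]) :
    Stab (Px * Py * (Px ^ 3 + Py ^ 3)) = ↑(Subgroup.closure {D, S}) ∧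
    Nat.card (Subgroup.closure {D, S} : Subgroup (SpecialLinearGroup (Fin 2) ℂ)) = 12 := by
  have hε0 : ε ≠ 0 := hε.ne_zero (by norm_num)
  have hDpow (k : ℕ) : ((D ^ k : SpecialLinearGroup (Fin 2) ℂ) : Matrix (Fin 2) (Fin 2) ℂ) =
      !![ε ^ k, 0; 0, (ε ^ k)⁻¹] := by
    induction k with
    | zero => simp [one_fin_two]
    | succ k ih =>
      rw [pow_succ, Matrix.SpecialLinearGroup.coe_mul, ih, hD]
      simp [pow_succ, mul_comm]
  have hSDpow (k : ℕ) : ((S * D ^ k : SpecialLinearGroup (Fin 2) ℂ) :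
      Matrix (Fin 2) (Fin 2) ℂ) = !![0, Complex.I * (ε ^ k)⁻¹; Complex.I * ε ^ k, 0] := by
    rw [Matrix.SpecialLinearGroup.coe_mul, hDpow, hS]
    simp
  let F : Fin 6 ⊕ Fin 6 → SpecialLinearGroup (Fin 2) ℂ :=
    Sum.elim (fun k => D ^ (k : ℕ)) (fun k => S * D ^ (k : ℕ))
  have hF : Function.Injective F := by
    have hD' : Function.Injective fun k : Fin 6 => D ^ (k : ℕ) := fun j k hjk => by
      have h := congrArg (fun A : SpecialLinearGroup (Fin 2) ℂ => A.1 0 0) hjk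
      simp only [hDpow] at h
      exact Fin.ext (hε.pow_inj j.2 k.2 (by simpa using h))
    refine hD'.sumElim ((mul_right_injective S).comp hD') fun j k hjk => ?_
    have h := congrArg (fun A : SpecialLinearGroup (Fin 2) ℂ => A.1 0 0) hjk
    simp only [hDpow, hSDpow] at h
    exact pow_ne_zero (j : ℕ) hε0 (by simpa using h)
  have hle : Subgroup.closure {D, S} ≤ stabSubgroup (Px * Py * (Px ^ 3 + Py ^ 3)) := by
    rw [Subgroup.closure_le]
    have h3 : (ε⁻¹) ^ 3 = ε ^ 3 := by
      refine (inv_pow ε 3).trans (eq_inv_of_mul_eq_one_left ?_).symm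
      rw [← pow_add]
      exact hε.pow_eq_one
    rintro A (rfl | rfl)
    · refine (semiInv_quintic_iff _).2 ⟨ε ^ 3, pow_ne_zero _ hε0, fun x y => ?_⟩
      simp only [hD, of_apply, cons_val', cons_val_zero, cons_val_one, cons_val_fin_one]
      linear_combination (x * y * (ε ^ 3 * x ^ 3 + ε⁻¹ ^ 3 * y ^ 3)) * mul_inv_cancel₀ hε0
        + x * y ^ 4 * h3
    · refine (semiInv_quintic_iff _).2 ⟨Complex.I, Complex.I_ne_zero, fun x y => ?_⟩
      simp only [hS, of_apply, cons_val', cons_val_zero, cons_val_one, cons_val_fin_one]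
      linear_combination Complex.I * (Complex.I ^ 2 - 1) * (x * y * (x ^ 3 + y ^ 3)) *
        Complex.I_sq
  have hrange : Set.range F ⊆ Subgroup.closure {D, S} := by
    have hDm : D ∈ Subgroup.closure {D, S} := Subgroup.subset_closure (by simp)
    have hSm : S ∈ Subgroup.closure {D, S} := Subgroup.subset_closure (by simp)
    rintro _ ⟨k | k, rfl⟩
    · exact pow_mem hDm _
    · exact mul_mem hSm (pow_mem hDm _)
  have hstab : Stab (Px * Py * (Px ^ 3 + Py ^ 3)) ⊆ Set.range F := by
    intro A hA
    obtain ⟨c, -, h⟩ := (semiInv_quintic_iff _).1 hA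
    have hdet := A.2
    rw [det_fin_two] at hdet
    have hA := eta_fin_two A.1
    obtain ⟨h01, h10, h3⟩ | ⟨h00, h11, h3⟩ := entries_of_quintic_semiInv hdet h
    · have hps : A.1 0 0 * A.1 1 1 = 1 := by simpa [h01] using hdet
      have h6 : A.1 0 0 ^ 6 = 1 := by
        linear_combination A.1 0 0 ^ 3 * h3 +
          ((A.1 0 0 * A.1 1 1) ^ 2 + A.1 0 0 * A.1 1 1 + 1) * hps
      obtain ⟨k, hk, hpk⟩ := hε.eq_pow_of_pow_eq_one h6
      refine ⟨Sum.inl ⟨k, hk⟩, Subtype.ext ?_⟩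
      rw [hA, h01, h10, eq_inv_of_mul_eq_one_right hps, ← hpk]
      exact hDpow k
    · have hqr : A.1 0 1 * A.1 1 0 = -1 := by
        linear_combination A.1 1 1 * h00 - hdet
      have h6 : (-Complex.I * A.1 1 0) ^ 6 = 1 := by
        have hI : Complex.I ^ 6 = -1 := by
          linear_combination (Complex.I ^ 4 - Complex.I ^ 2 + 1) * Complex.I_sq
        linear_combination A.1 1 0 ^ 6 * hI + A.1 1 0 ^ 3 * h3 -
          ((A.1 0 1 * A.1 1 0) ^ 2 - A.1 0 1 * A.1 1 0 + 1) * hqr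
      obtain ⟨k, hk, hrk⟩ := hε.eq_pow_of_pow_eq_one h6
      have hr : A.1 1 0 = Complex.I * ε ^ k := by
        linear_combination -Complex.I * hrk + A.1 1 0 * Complex.I_sq
      have hq : A.1 0 1 = Complex.I * (ε ^ k)⁻¹ := by
        rw [← div_eq_mul_inv, eq_div_iff (pow_ne_zero _ hε0)]
        linear_combination -Complex.I * hqr + A.1 0 1 * hrk
      refine ⟨Sum.inr ⟨k, hk⟩, Subtype.ext ?_⟩
      rw [hA, h00, h11, hr, hq]
      exact hSDpow k
  have hclosure : (Subgroup.closure {D, S} : Set (SpecialLinearGroup (Fin 2) ℂ)) = Set.range F :=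
    (Set.Subset.trans hle hstab).antisymm hrange
  refine ⟨(hstab.trans hrange).antisymm hle, ?_⟩
  rw [← SetLike.coe_sort_coe, hclosure, Nat.card_range_of_injective hF]
  simp

end
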